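/- Let M₇ be the Turing machine with states {A,B,C,D,E,F,H} and symbols {0,1} whose transition table is: δ(A,0)=(1,R,B), δ(A,1)=(0,L,B); δ(B,0)=(0,R,C), δ(B,1)=(1,L,B); δ(C,0)=(1,R,D), δ(C,1)=(0,L,A); δ(D,0)=(1,L,E), δ(D,1)=(1,L,F); δ(E,0)=(1,L,A), δ(E,1)=(0,L,D); δ(F,0)=(1,R,H), δ(F,1)=(1,L,E). Let C(n) = ^ω0 1^n (B0) 0^ω. Then: (a) ^ω0 (A0) 0^ω ⊢(1) C(1); and for all k ≥ 0: (b) C(3k) ⊢(54·4^{k+1} − 27·2^{k+3} + 26k + 86) C(9·2^{k+1} − 8); (c) C(3k+1) ⊢(2048·(4^k − 1)/3 − 3·2^{k+7} + 26k + 792) C(2^{k+5} − 8); (d) C(3k+2) ⊢(3k+8) ^ω0 1 (H1) (011)^k 0 1 0 1 0^ω. -/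

import Mathlib

open Turing

inductive TSt where | A | B | C | D | E | F | H
deriving DecidableEq

inductive Gam where | s0 | s1
deriving DecidableEq

instance : Inhabited Gam := ⟨Gam.s0⟩

abbrev Cfg := TSt × Tape Gam

/-- The transition table of the machine (values from the halting state `H` are never used). -/
def delta : TSt → Gam → Gam × Dir × TSt
  | .A, .s0 => (.s1, Dir.right, .B)
  | .A, .s1 => (.s0, Dir.left, .B)
  | .B, .s0 => (.s0, Dir.right, .C)
  | .B, .s1 => (.s1, Dir.left, .B)
  | .C, .s0 => (.s1, Dir.right, .D)
  | .C, .s1 => (.s0, Dir.left, .A)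
  | .D, .s0 => (.s1, Dir.left, .E)
  | .D, .s1 => (.s1, Dir.left, .F)
  | .E, .s0 => (.s1, Dir.left, .A)
  | .E, .s1 => (.s0, Dir.left, .D)
  | .F, .s0 => (.s1, Dir.right, .H)
  | .F, .s1 => (.s1, Dir.left, .E)
  | .H, a => (a, Dir.right, .H)

/-- One computation step; `none` if the current state is the halting state `H`. -/
def step (c : Cfg) : Option Cfg :=
  if c.1 = TSt.H then none
  else
    let t := delta c.1 c.2.head
    some (t.2.2, (c.2.write t.1).move t.2.1)

/-- `reaches t c₁ c₂` : iterating `step` exactly `t` times starting from `c₁` yields `c₂`. -/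
def reaches (t : ℕ) (c₁ c₂ : Cfg) : Prop :=
  (fun c => Option.bind c step)^[t] (some c₁) = some c₂

/-- The configuration `^ω0 x (q a) y 0^ω` : state `q`, head reading `a`, the word `x`
written immediately to the left of the head (in order), `y` immediately to the right,
blank elsewhere. -/
def mkCfg (x : List Gam) (q : TSt) (a : Gam) (y : List Gam) : Cfg :=
  (q, ⟨a, ListBlank.mk x.reverse, ListBlank.mk y⟩)

/-- `C(n) = ^ω0 1^n (B0) 0^ω`. -/
def Cfg7 (n : ℕ) : Cfg := mkCfg (List.replicate n .s1) .B .s0 []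

/-- The all-blank half-tape. -/
def blank : ListBlank Gam := ListBlank.mk []

/-- The half-tape `L` with `n` ones pushed in front of it. -/
def ones : ℕ → ListBlank Gam → ListBlank Gam
  | 0, L => L
  | n + 1, L => (ones n L).cons .s1

/-- The half-tape `(011)^k` followed by `X`. -/
def blocks : ℕ → ListBlank Gam → ListBlank Gam
  | 0, X => X
  | k + 1, X => (((blocks k X).cons .s1).cons .s1).cons .s0

/-- The configuration in state `q` reading `a`, with half-tapes `L` and `R` on either side. -/
def conf (q : TSt) (L : ListBlank Gam) (a : Gam) (R : ListBlank Gam) : Cfg := (q, ⟨a, L, R⟩)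

/-- The configuration `^ω0 (A0) 0 1^m X`. -/
def sweepCfg (m : ℕ) (X : ListBlank Gam) : Cfg := conf .A blank .s0 ((ones m X).cons .s0)

/-- The half-tape `0101` followed by blanks. -/
def tailWord : ListBlank Gam := (((blank.cons .s1).cons .s0).cons .s1).cons .s0

lemma head_blank : blank.head = .s0 := rfl

lemma tail_blank : blank.tail = blank := rfl

lemma cons_blank : blank.cons .s0 = blank := by
  rw [← head_blank]; conv_lhs => rw [← tail_blank]
  exact ListBlank.cons_head_tail _

lemma ones_cons (n : ℕ) (L : ListBlank Gam) : ones n (L.cons .s1) = (ones n L).cons .s1 := by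
  induction n with
  | zero => rfl
  | succ n ih => simp [ones, ih]

lemma ones_ones (m n : ℕ) (L : ListBlank Gam) : ones m (ones n L) = ones (m + n) L := by
  induction m with
  | zero => simp [ones]
  | succ m ih => rw [Nat.succ_add]; simp [ones, ih]

lemma blocks_cons (k : ℕ) (X : ListBlank Gam) :
    blocks k (((X.cons .s1).cons .s1).cons .s0) = blocks (k + 1) X := by
  induction k with
  | zero => rfl
  | succ k ih => rw [blocks, ih]; rfl

lemma reaches_zero (c : Cfg) : reaches 0 c c := rfl

lemma reaches.trans {s t : ℕ} {a b c : Cfg} (h₁ : reaches s a b) (h₂ : reaches t b c) :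
    reaches (s + t) a c := by
  unfold reaches at *
  rw [add_comm, Function.iterate_add_apply, h₁, h₂]

/-- Unfolds one computation step of `reaches`. -/
lemma reaches_add_one (t : ℕ) (q : TSt) (L R : ListBlank Gam) (a : Gam) (c : Cfg) (hq : q ≠ .H) :
    reaches (t + 1) (conf q L a R) c ↔
      reaches t (match delta q a with
        | (b, .right, q') => conf q' (L.cons b) R.head R.tail
        | (b, .left, q') => conf q' L.tail L.head (R.cons b)) c := by
  have h : step (conf q L a R) = some (match delta q a with
        | (b, .right, q') => conf q' (L.cons b) R.head R.tail
        | (b, .left, q') => conf q' L.tail L.head (R.cons b)) := by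
    rcases hd : delta q a with ⟨b, d, q'⟩
    cases d <;> simp [step, conf, hq, hd, Tape.move, Tape.write]
  unfold reaches
  rw [Function.iterate_succ_apply, Option.bind_some, h]

/-- Running `B` left through a block of ones and turning around at the blank. -/
lemma reaches_turn (n : ℕ) (R : ListBlank Gam) :
    reaches (n + 3) (conf .B (ones n blank) .s1 R) (sweepCfg n R) := by
  induction n generalizing R with
  | zero =>
    simp [reaches_add_one, delta, ones, head_blank, tail_blank, cons_blank, sweepCfg, reaches_zero]
  | succ n ih =>
    have := ih (R.cons .s1)
    rw [sweepCfg, ones_cons] at this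
    rw [Nat.add_right_comm, reaches_add_one _ _ _ _ _ _ (by decide)]
    simpa [delta, ones, sweepCfg] using this

lemma reaches_sweep (m j : ℕ) (X : ListBlank Gam) :
    reaches (3 * m) (conf .A (ones j blank) .s0 ((ones m X).cons .s0))
      (conf .A (ones (j + m) blank) .s0 (X.cons .s0)) := by
  induction m generalizing j with
  | zero => exact reaches_zero _
  | succ m ih =>
    have := ih (j + 1)
    rw [Nat.add_right_comm] at this
    simpa [Nat.mul_succ, reaches_add_one, delta, ones] using this

lemma sweepCfg_reaches_pass (m : ℕ) (Y : ListBlank Gam) :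
    reaches (3 * m + 6) (sweepCfg m ((Y.cons .s1).cons .s0))
      (conf .A (ones m blank) .s1 (((Y.cons .s1).cons .s1).cons .s1)) := by
  refine (reaches_sweep m 0 _).trans ?_
  simp [reaches_add_one, delta, reaches_zero]

lemma sweepCfg_reaches_final (m : ℕ) :
    reaches (3 * m + 1) (sweepCfg m blank) (conf .B (ones (m + 1) blank) .s0 blank) := by
  refine (reaches_sweep m 0 _).trans ?_
  simp [reaches_add_one, delta, reaches_zero, ones, cons_blank, head_blank, tail_blank]

/-- One pass of the inner loop moves a cell of the left block and a new one to the right block. -/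
lemma reaches_pass (n b : ℕ) (Y : ListBlank Gam) :
    reaches (4 * n + 10) (conf .A (ones (n + 1) blank) .s1 (ones (b + 1) Y))
      (conf .A (ones n blank) .s1 (ones (b + 3) Y)) := by
  have h := (reaches_turn n ((ones (b + 1) Y).cons .s0)).trans
    (sweepCfg_reaches_pass n (ones b Y))
  rw [show 4 * n + 10 = n + 3 + (3 * n + 6) + 1 by ring, reaches_add_one _ _ _ _ _ _ (by decide)]
  simpa [delta, ones] using h

lemma reaches_passes (n b : ℕ) (Y : ListBlank Gam) :
    reaches (2 * n ^ 2 + 8 * n) (conf .A (ones n blank) .s1 (ones (b + 1) Y))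
      (conf .A blank .s1 (ones (b + 2 * n + 1) Y)) := by
  induction n generalizing b with
  | zero => exact reaches_zero _
  | succ n ih =>
    have h := (reaches_pass n b Y).trans (ih (b + 2))
    convert h using 1 <;> ring_nf

lemma reaches_restart (b : ℕ) (Y : ListBlank Gam) :
    reaches 11 (conf .A blank .s1 (ones (b + 1) Y)) (sweepCfg (b + 3) Y) := by
  simp [reaches_add_one, delta, reaches_zero, ones, head_blank, tail_blank, cons_blank, sweepCfg]

lemma sweepCfg_reaches_sweepCfg (m b : ℕ) (Y : ListBlank Gam) :
    reaches (2 * m ^ 2 + 11 * m + 17) (sweepCfg m ((ones (b + 1) Y).cons .s0))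
      (sweepCfg (2 * m + b + 5) Y) := by
  have h := ((sweepCfg_reaches_pass m (ones b Y)).trans (reaches_passes m (b + 2) Y)).trans
    (reaches_restart _ Y)
  convert h using 1
  · ring
  · rfl
  · rw [show b + 2 + 2 * m + 3 = 2 * m + b + 5 by ring]

lemma sweepCfg_blocks (k a : ℕ) (Z : ListBlank Gam) :
    ∃ t, 3 * t + 39 * ((a + 6) * 2 ^ k) + 2 * (a + 6) ^ 2
        = 2 * ((a + 6) * 2 ^ k) ^ 2 + 39 * (a + 6) + 69 * k ∧
      ∃ m, m + 6 = (a + 6) * 2 ^ k ∧ reaches t (sweepCfg a (blocks k Z)) (sweepCfg m Z) := by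
  induction k generalizing a with
  | zero => exact ⟨0, by ring, a, by ring, reaches_zero _⟩
  | succ k ih =>
    obtain ⟨t, ht, m, hm, h⟩ := ih (2 * a + 6)
    have e : (2 * a + 6 + 6) * 2 ^ k = (a + 6) * 2 ^ (k + 1) := by ring
    rw [e] at ht hm
    exact ⟨2 * a ^ 2 + 11 * a + 17 + t, by linarith, m, hm,
      (sweepCfg_reaches_sweepCfg a 1 (blocks k Z)).trans h⟩

lemma sweepCfg_tailWord (a : ℕ) :
    reaches (10 * a ^ 2 + 85 * a + 185) (sweepCfg a tailWord)
      (conf .B (ones (4 * a + 16) blank) .s0 blank) := by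
  have h := ((sweepCfg_reaches_sweepCfg a 0 _).trans
    (sweepCfg_reaches_sweepCfg _ 0 blank)).trans (sweepCfg_reaches_final _)
  convert h using 1
  · ring
  · rfl
  · ring_nf

lemma sweepCfg_reaches_end (k a : ℕ) :
    ∃ t, 3 * t + 144 * ((a + 6) * 2 ^ k) + 2 * (a + 6) ^ 2
        = 32 * ((a + 6) * 2 ^ k) ^ 2 + 39 * (a + 6) + 69 * k + 105 ∧
      ∃ m, m + 8 = 4 * ((a + 6) * 2 ^ k) ∧
        reaches t (sweepCfg a (blocks k tailWord)) (conf .B (ones m blank) .s0 blank) := by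
  obtain ⟨t, ht, m, hm, h⟩ := sweepCfg_blocks k a tailWord
  refine ⟨t + (10 * m ^ 2 + 85 * m + 185), ?_, 4 * m + 16, by omega, h.trans (sweepCfg_tailWord m)⟩
  rw [← hm] at ht ⊢
  nlinarith

lemma Cfg7_eq (n : ℕ) : Cfg7 n = conf .B (ones n blank) .s0 blank := by
  have h : ones n blank = ListBlank.mk (List.replicate n .s1) := by
    induction n with
    | zero => rfl
    | succ n ih => rw [ones, ih, ListBlank.cons_mk]; rfl
  rw [h]; simp [Cfg7, mkCfg, conf, blank]

lemma reaches_blocks (k : ℕ) (L Z : ListBlank Gam) :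
    reaches (3 * k) (conf .D (ones (3 * k) L) .s1 Z) (conf .D L .s1 (blocks k Z)) := by
  induction k generalizing Z with
  | zero => exact reaches_zero _
  | succ k ih =>
    rw [← blocks_cons]
    simpa [Nat.mul_succ, reaches_add_one, delta, ones] using ih _

lemma Cfg7_reaches_blocks (k r : ℕ) :
    reaches (3 * k + 6) (Cfg7 (3 * k + r + 2))
      (conf .D (ones r blank) .s1 (blocks k tailWord)) := by
  have h := reaches_blocks k (ones r blank) tailWord
  rw [ones_ones] at h
  rw [Cfg7_eq]
  simpa [reaches_add_one, delta, ones, head_blank, tail_blank, tailWord] using h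

lemma Cfg7_reaches_sweepCfg_zero (k : ℕ) :
    reaches (3 * k + 14) (Cfg7 (3 * k + 3)) (sweepCfg 3 (blocks k tailWord)) := by
  refine (Cfg7_reaches_blocks k 1).trans (t := 8) ?_
  simp [reaches_add_one, delta, reaches_zero, ones, head_blank, tail_blank, cons_blank, sweepCfg]

lemma Cfg7_reaches_sweepCfg_one (k : ℕ) :
    reaches (3 * k + 13) (Cfg7 (3 * k + 1)) (sweepCfg 2 (blocks k tailWord)) := by
  cases k with
  | zero =>
    simp [Cfg7_eq, reaches_add_one, delta, reaches_zero, ones, head_blank, tail_blank, cons_blank,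
      sweepCfg, blocks, tailWord]
  | succ k =>
    refine (Cfg7_reaches_blocks k 2).trans (t := 10) ?_
    simp [reaches_add_one, delta, reaches_zero, ones, head_blank, tail_blank, cons_blank, sweepCfg,
      blocks]

lemma Cfg7_zero_reaches : reaches 86 (Cfg7 0) (Cfg7 10) := by
  have h₁ : reaches 11 (Cfg7 0) (sweepCfg 2 ((ones 1 blank).cons .s0)) := by
    simp [Cfg7_eq, reaches_add_one, delta, reaches_zero, ones, head_blank, tail_blank, cons_blank,
      sweepCfg]
  have h := (h₁.trans (sweepCfg_reaches_sweepCfg 2 0 blank)).trans (sweepCfg_reaches_final _)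
  rw [← Cfg7_eq] at h
  exact h

lemma append_blocks (k : ℕ) (Z : List Gam) :
    ListBlank.mk ((List.replicate k [Gam.s0, .s1, .s1]).flatten ++ Z)
      = blocks k (ListBlank.mk Z) := by
  induction k with
  | zero => rfl
  | succ k ih => simp [blocks, ← ih, List.replicate_succ]

theorem stmt18 :
    reaches 1 (mkCfg [] .A .s0 []) (Cfg7 1) ∧
    ∀ k : ℕ,
      reaches (54*4^(k+1) - 27*2^(k+3) + 26*k + 86) (Cfg7 (3*k)) (Cfg7 (9*2^(k+1) - 8)) ∧
      reaches (2048*(4^k - 1)/3 + 26*k + 792 - 3*2^(k+7)) (Cfg7 (3*k+1)) (Cfg7 (2^(k+5) - 8)) ∧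
      reaches (3*k + 8) (Cfg7 (3*k+2))
        (mkCfg [.s1] .H .s1
          ((List.replicate k [Gam.s0, .s1, .s1]).flatten ++ [.s0, .s1, .s0, .s1])) := by
  refine ⟨?_, fun k => ⟨?_, ?_, ?_⟩⟩
  · rw [Cfg7_eq]
    change reaches 1 (conf .A blank .s0 blank) _
    simp [reaches_add_one, delta, reaches_zero, ones, head_blank, tail_blank]
  · cases k with
    | zero => exact Cfg7_zero_reaches
    | succ k =>
      obtain ⟨t, ht, m, hm, h⟩ := sweepCfg_reaches_end k 3
      have h' := (Cfg7_reaches_sweepCfg_zero k).trans h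
      rw [← Cfg7_eq] at h'
      have e : (4 : ℕ) ^ k = (2 ^ k) ^ 2 := by rw [← pow_mul, mul_comm, pow_mul]; norm_num
      have hx : 2 ^ k ≤ (2 ^ k) ^ 2 := Nat.le_self_pow two_ne_zero _
      convert h' using 1
      · rw [pow_succ 4, pow_succ 4, e, pow_add 2 (k + 1), pow_succ 2 k]
        rw [mul_pow] at ht
        generalize (2 ^ k) ^ 2 = y at *
        omega
      · rfl
      · congr 1
        rw [pow_succ, pow_succ]
        omega
  · obtain ⟨t, ht, m, hm, h⟩ := sweepCfg_reaches_end k 2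
    have h' := (Cfg7_reaches_sweepCfg_one k).trans h
    rw [← Cfg7_eq] at h'
    have e : (4 : ℕ) ^ k = (2 ^ k) ^ 2 := by rw [← pow_mul, mul_comm, pow_mul]; norm_num
    have hx : 2 ^ k ≤ (2 ^ k) ^ 2 := Nat.le_self_pow two_ne_zero _
    convert h' using 1
    · rw [e, pow_add]
      rw [mul_pow] at ht
      generalize (2 ^ k) ^ 2 = y at *
      omega
    · congr 1
      rw [pow_add]
      omega
  · refine (Cfg7_reaches_blocks k 0).trans (t := 2) ?_
    have h : mkCfg [.s1] .H .s1
        ((List.replicate k [Gam.s0, .s1, .s1]).flatten ++ [.s0, .s1, .s0, .s1])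
        = conf .H (blank.cons .s1) .s1 (blocks k tailWord) := by
      simp [mkCfg, conf, append_blocks, blank, tailWord]
    rw [h]
    simp [reaches_add_one, delta, reaches_zero, ones, head_blank, tail_blank]
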